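/- Let P(Z_k, X_n, Y_{n−1}) be the poset on {z_1,…,z_k} ∪ {x_1,…,x_n} ∪ {y_1,…,y_{n−1}} with relations x_i ≺ z_j for all i, j, and y_i ≺ x_i, y_i ≺ x_{i+1} for i = 1,…,n−1 (and those implied by transitivity). Then its Greene sum equals G(P(Z_k, X_n, Y_{n−1})) = (−1)^{k−1} Δ_{Z_k}[g/f] / T(X_n, Y_{n−1}), where f(x) = ∏_{j=1}^n (x − x_j), g(x) = ∏_{j=1}^{n−1} (x − y_j), and T(X_n, Y_{n−1}) = ∏_{j=1}^{n−1} (x_j − y_j)(x_{j+1} − y_j). -/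

import Mathlib

open scoped Classical

noncomputable section

/-- The position `m` (as an element of `Fin n`) for `m : Fin (n-1)`. -/
def idxLo {n : ℕ} (m : Fin (n - 1)) : Fin n := ⟨m.1, by have := m.2; omega⟩

/-- The position `m+1` (as an element of `Fin n`) for `m : Fin (n-1)`. -/
def idxHi {n : ℕ} (m : Fin (n - 1)) : Fin n := ⟨m.1 + 1, by have := m.2; omega⟩

/-- The Greene sum of a finite poset, given by a strict order relation `r`
(`r u v` means `u ≺ v`) on a finite index type `ι`, with variables `x : ι → K`:
the sum over all linear extensions (words listing the elements from maximal to
minimal) of the product of the inverses of consecutive differences. -/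
def greeneSum {ι : Type*} [Fintype ι] {K : Type*} [Field K]
    (r : ι → ι → Prop) (x : ι → K) : K :=
  ∑ α : Equiv.Perm (Fin (Fintype.card ι)),
    if ∀ i j : Fin (Fintype.card ι),
        r ((Fintype.equivFin ι).symm (α i)) ((Fintype.equivFin ι).symm (α j)) → j < i
    then ∏ m : Fin (Fintype.card ι - 1),
        (x ((Fintype.equivFin ι).symm (α (idxLo m))) -
          x ((Fintype.equivFin ι).symm (α (idxHi m))))⁻¹
    else 0

/-- `Z` is a separating subset of the poset `(ι, r)`: elements of `Z` are pairwise
incomparable and every element outside `Z` is either below every element of `Z` or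
above every element of `Z`. -/
def IsSeparating {ι : Type*} (r : ι → ι → Prop) (Z : Set ι) : Prop :=
  (∀ a ∈ Z, ∀ b ∈ Z, a ≠ b → ¬ r a b ∧ ¬ r b a) ∧
  ∀ u ∉ Z, (∀ a ∈ Z, r u a) ∨ (∀ a ∈ Z, r a u)

/-- `P^≺`: the set of elements lying below every element of `Z`. -/
def below {ι : Type*} (r : ι → ι → Prop) (Z : Set ι) : Set ι := {u | ∀ a ∈ Z, r u a}

/-- `P^≻`: the set of elements lying above every element of `Z`. -/
def above {ι : Type*} (r : ι → ι → Prop) (Z : Set ι) : Set ι := {u | ∀ a ∈ Z, r a u}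

/-- Adjoin a new minimum (the element `none`) to a poset. -/
def adjoinMin {ι : Type*} (r : ι → ι → Prop) : Option ι → Option ι → Prop
  | none, some _ => True
  | some a, some b => r a b
  | _, _ => False

/-- Adjoin a new maximum (the element `none`) to a poset. -/
def adjoinMax {ι : Type*} (r : ι → ι → Prop) : Option ι → Option ι → Prop
  | some _, none => True
  | some a, some b => r a b
  | _, _ => False

/-- Extend variables `x : ι → K` to `Option ι` by assigning the value `z` to the
adjoined element `none`. -/
def extendVar {ι K : Type*} (x : ι → K) (z : K) : Option ι → K
  | none => z
  | some a => x a

/-- The Newton divided difference `Δ_{Z_k}[φ]` at the nodes `z 1, …, z k`. -/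
def dividedDiff {K : Type*} [Field K] {k : ℕ} (z : Fin k → K) (φ : K → K) : K :=
  ∑ j : Fin k, φ (z j) * (∏ i ∈ Finset.univ.erase j, (z j - z i))⁻¹


/-- A word is listed from maximal to minimal for `r` if no letter is `r`-below itself
or a later letter. -/
def ListsDown {ι : Type*} (r : ι → ι → Prop) : List ι → Prop
  | [] => True
  | a :: l => (∀ c ∈ a :: l, ¬ r a c) ∧ ListsDown r l

/-- The product of the inverses of the consecutive differences of a word. -/
def wordWeight {ι K : Type*} [Field K] (x : ι → K) : List ι → K
  | [] => 1
  | [_] => 1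
  | a :: b :: l => (x a - x b)⁻¹ * wordWeight x (b :: l)

/-- The contribution of a word to the Greene sum. -/
def wordTerm {ι K : Type*} [Field K] (x : ι → K) (r : ι → ι → Prop) (l : List ι) : K :=
  if ListsDown r l then wordWeight x l else 0

/-- The Greene sum of the relation `r` restricted to the letters of the list `L`. -/
def wordSum {ι K : Type*} [Field K] (x : ι → K) (r : ι → ι → Prop) (L : List ι) : K :=
  (L.permutations'.map (wordTerm x r)).sum

/-- The injection `pos` on the letters of `L` is order reversing. -/
def Reverses {ι : Type*} (r : ι → ι → Prop) (L : List ι) (pos : ι → ℕ) : Prop :=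
  ∀ a ∈ L, ∀ b ∈ L, r a b → pos b < pos a

section Words

variable {ι K : Type*} [Field K] {x : ι → K} {r : ι → ι → Prop}

theorem wordTerm_cons_cons (a b : ι) (l : List ι) :
    wordTerm x r (a :: b :: l) =
      (if ∀ c ∈ a :: b :: l, ¬ r a c then (x a - x b)⁻¹ else 0) * wordTerm x r (b :: l) := by
  unfold wordTerm
  rw [ListsDown, wordWeight]
  split_ifs <;> simp_all

theorem wordTerm_eq_zero {a c : ι} {l : List ι} (hc : c ∈ l) (h : r a c) :
    wordTerm x r (a :: l) = 0 := by
  unfold wordTerm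
  rw [ListsDown, if_neg]
  exact fun H => H.1 c (List.mem_cons_of_mem _ hc) h

theorem mem_of_mem_permutations'Aux {u c : ι} {t l : List ι}
    (hl : l ∈ List.permutations'Aux u t) : c ∈ l ↔ c = u ∨ c ∈ t := by
  induction t generalizing l with
  | nil => simp_all
  | cons a t ih =>
    simp only [List.permutations'Aux, List.mem_cons, List.mem_map] at hl
    rcases hl with rfl | ⟨l', hl', rfl⟩
    · simp
    · simp only [List.mem_cons, ih hl']
      tauto

theorem listsDown_iff_reverses {l : List ι} (hl : l.Nodup) :
    ListsDown r l ↔ Reverses r l (fun a => l.idxOf a) := by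
  induction l with
  | nil => simp [ListsDown, Reverses]
  | cons a l ih =>
    obtain ⟨ha, hl⟩ := List.nodup_cons.1 hl
    rw [ListsDown, ih hl]
    have key : ∀ b ∈ l, (a :: l).idxOf b = l.idxOf b + 1 := fun b hb =>
      List.idxOf_cons_ne _ (fun h => ha (h ▸ hb))
    constructor
    · rintro ⟨h1, h2⟩ b hb c hc hbc
      rcases List.mem_cons.1 hb with rfl | hb
      · exact absurd hbc (h1 c hc)
      rcases List.mem_cons.1 hc with hca | hc
      · simp only [key b hb, hca, List.idxOf_cons_self]
        omega
      · have : l.idxOf c < l.idxOf b := h2 b hb c hc hbc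
        simp only [key b hb, key c hc]
        omega
    · intro h
      refine ⟨fun c hc hac => ?_, fun b hb c hc hbc => ?_⟩
      · have := h a (by simp) c hc hac
        simp at this
      · have := h b (by simp [hb]) c (by simp [hc]) hbc
        simp only [key b hb, key c hc] at this
        show l.idxOf c < l.idxOf b
        omega

theorem wordSum_perm {L L' : List ι} (h : L.Perm L') : wordSum x r L = wordSum x r L' :=
  (h.permutations'.map _).sum_eq

theorem list_sum_map_finset_sum {α β M : Type*} [AddCommMonoid M] (l : List α) (s : Finset β)
    (f : β → α → M) :
    (l.map fun a => ∑ j ∈ s, f j a).sum = ∑ j ∈ s, (l.map (f j)).sum := by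
  induction l with
  | nil => simp
  | cons a l ih => simp [ih, Finset.sum_add_distrib]

theorem wordSum_eq_sum {β : Type*} {L : List ι} (hL : L.Nodup) (s : Finset β)
    (r' : β → ι → ι → Prop)
    (h : ∀ pos : ι → ℕ, (∀ a ∈ L, ∀ b ∈ L, pos a = pos b → a = b) →
      (if Reverses r L pos then 1 else 0 : K) =
        ∑ j ∈ s, if Reverses (r' j) L pos then 1 else 0) :
    wordSum x r L = ∑ j ∈ s, wordSum x (r' j) L := by
  unfold wordSum
  rw [← list_sum_map_finset_sum]
  congr 1
  refine List.map_congr_left fun l hl => ?_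
  rw [List.mem_permutations'] at hl
  have hn : l.Nodup := hl.nodup_iff.2 hL
  have hR : ∀ q : ι → ι → Prop, Reverses q l = Reverses q L := by
    intro q
    ext pos
    simp only [Reverses, hl.mem_iff]
  have hF : ∀ q : ι → ι → Prop, wordTerm x q l =
      (if Reverses q L (fun a => l.idxOf a) then 1 else 0) * wordWeight x l := by
    intro q
    rw [wordTerm, ← hR, ite_mul, one_mul, zero_mul]
    simp only [listsDown_iff_reverses hn]
  simp only [hF]
  rw [h, Finset.sum_mul]
  intro a ha b hb hab
  exact (List.idxOf_inj (hl.mem_iff.2 ha)).1 hab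

theorem wordSum_congr {L : List ι} (hL : L.Nodup) {r' : ι → ι → Prop}
    (h : ∀ pos : ι → ℕ, Reverses r L pos ↔ Reverses r' L pos) :
    wordSum x r L = wordSum x r' L := by
  rw [wordSum_eq_sum hL {()} (fun _ => r')]
  · simp
  · intro pos _
    simp [h]

/-- Every linear order on the letters puts one of two distinct letters first. -/
theorem wordSum_split {L : List ι} (hL : L.Nodup) {a b : ι} (ha : a ∈ L) (hb : b ∈ L)
    (hab : a ≠ b) :
    wordSum x r L = wordSum x (fun p q => r p q ∨ (p = a ∧ q = b)) L +
      wordSum x (fun p q => r p q ∨ (p = b ∧ q = a)) L := by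
  rw [wordSum_eq_sum hL (Finset.univ : Finset Bool)
    (fun t p q => r p q ∨ bif t then (p = a ∧ q = b) else (p = b ∧ q = a))]
  · simp
  · intro pos hpos
    have key : ∀ {c d : ι}, c ∈ L → d ∈ L → (Reverses (fun p q => r p q ∨ (p = c ∧ q = d)) L pos ↔
        Reverses r L pos ∧ pos d < pos c) := by
      intro c d hc hd
      constructor
      · exact fun h => ⟨fun p hp q hq hpq => h p hp q hq (Or.inl hpq),
          h c hc d hd (Or.inr ⟨rfl, rfl⟩)⟩
      · rintro ⟨h1, h2⟩ p hp q hq (hpq | ⟨rfl, rfl⟩)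
        · exact h1 p hp q hq hpq
        · exact h2
    simp only [Fintype.sum_bool, cond_true, cond_false, key ha hb, key hb ha]
    have hne : pos a ≠ pos b := fun h => hab (hpos a ha b hb h)
    by_cases hR : Reverses r L pos
    · rcases lt_or_gt_of_ne hne with h | h
      · simp [hR, h, h.le]
      · simp [hR, h, h.le]
    · simp [hR]

theorem sum_insert_free {u a : ι} {t : List ι} (hr : ∀ c ∈ u :: a :: t, ¬ r c u)
    (hu : ∀ c ∈ t, ¬ r u c) (hx : ((u :: a :: t).map x).Nodup) :
    ((List.permutations'Aux u t).map fun l => wordTerm x r (a :: l)).sum =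
      (x a - x u)⁻¹ * wordTerm x r (a :: t) := by
  induction t generalizing a with
  | nil =>
    have h1 : ¬ r a u := hr a (by simp)
    have h2 : ¬ r u u := hr u (by simp)
    simp [wordTerm, ListsDown, wordWeight, h1, h2]
  | cons b s ih =>
    have hau : ¬ r a u := hr a (by simp)
    have huu : ¬ r u u := hr u (by simp)
    have hub : ∀ c ∈ u :: b :: s, ¬ r u c := by
      intro c hc
      rcases List.mem_cons.1 hc with rfl | hc
      · exact huu
      · exact hu c hc
    have hterm : ∀ l ∈ List.permutations'Aux u s, wordTerm x r (a :: b :: l) =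
        (if ∀ c ∈ a :: b :: s, ¬ r a c then (x a - x b)⁻¹ else 0) * wordTerm x r (b :: l) := by
      intro l hl
      rw [wordTerm_cons_cons]
      congr 1
      simp only [List.mem_cons, mem_of_mem_permutations'Aux hl]
      congr 1
      grind
    have hfirst : wordTerm x r (a :: u :: b :: s) =
        (if ∀ c ∈ a :: b :: s, ¬ r a c then (x a - x u)⁻¹ else 0) *
          ((x u - x b)⁻¹ * wordTerm x r (b :: s)) := by
      rw [wordTerm_cons_cons, wordTerm_cons_cons, if_pos hub]
      congr 1
      simp only [List.mem_cons]
      congr 1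
      grind
    rw [List.permutations'Aux, List.map_cons, List.sum_cons, List.map_map, hfirst]
    have : (List.map ((fun l => wordTerm x r (a :: l)) ∘ List.cons b)
        (List.permutations'Aux u s)) = List.map (fun l =>
        (if ∀ c ∈ a :: b :: s, ¬ r a c then (x a - x b)⁻¹ else 0) * wordTerm x r (b :: l))
        (List.permutations'Aux u s) := List.map_congr_left hterm
    rw [this, List.sum_map_mul_left, ih (a := b) (by grind) (by grind) (by grind),
      wordTerm_cons_cons (a := a)]
    have hxu : x u ≠ x a ∧ x u ≠ x b ∧ x a ≠ x b := by grind
    have e1 := sub_ne_zero.2 hxu.1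
    have e1' := sub_ne_zero.2 hxu.1.symm
    have e2 := sub_ne_zero.2 hxu.2.1
    have e2' := sub_ne_zero.2 hxu.2.1.symm
    have e3 := sub_ne_zero.2 hxu.2.2
    split_ifs
    · field_simp
      ring
    · ring

theorem sum_insert_below {u p : ι} {l : List ι} (hr : ∀ c ∈ u :: l, ¬ r c u)
    (hu : ∀ c ∈ l, r u c ↔ c = p) (hp : p ∈ l) (hx : ((u :: l).map x).Nodup) :
    ((List.permutations'Aux u l).map (wordTerm x r)).sum =
      (x p - x u)⁻¹ * wordTerm x r l := by
  induction l with
  | nil => simp at hp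
  | cons a t ih =>
    have h0 : wordTerm x r (u :: a :: t) = 0 := wordTerm_eq_zero hp ((hu p hp).2 rfl)
    rw [List.permutations'Aux, List.map_cons, List.sum_cons, List.map_map, h0, zero_add]
    by_cases hap : a = p
    · subst hap
      exact sum_insert_free hr (by grind) hx
    · obtain _ | ⟨b, s⟩ := t
      · grind
      have hpt : p ∈ b :: s := by grind
      have hterm : ∀ l ∈ List.permutations'Aux u (b :: s), wordTerm x r (a :: l) =
          (if ∀ c ∈ a :: b :: s, ¬ r a c then (x a - x b)⁻¹ else 0) * wordTerm x r l := by
        intro l hl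
        rw [List.permutations'Aux, List.mem_cons, List.mem_map] at hl
        rcases hl with rfl | ⟨l', hl', rfl⟩
        · rw [wordTerm_cons_cons, wordTerm_eq_zero hpt ((hu p hp).2 rfl), mul_zero, mul_zero]
        · rw [wordTerm_cons_cons]
          congr 1
          simp only [List.mem_cons, mem_of_mem_permutations'Aux hl']
          congr 1
          grind
      have : List.map (wordTerm x r ∘ List.cons a) (List.permutations'Aux u (b :: s)) =
          List.map (fun l => (if ∀ c ∈ a :: b :: s, ¬ r a c then (x a - x b)⁻¹ else 0) *
            wordTerm x r l) (List.permutations'Aux u (b :: s)) := List.map_congr_left hterm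
      rw [this, List.sum_map_mul_left, ih (by grind) (by grind) hpt (by grind),
        wordTerm_cons_cons (a := a)]
      ring

theorem sum_insert_between {u a p : ι} {t : List ι} (hu : ∀ c ∈ u :: a :: t, ¬ r u c)
    (hr : ∀ c ∈ a :: t, r c u ↔ c = p) (hp : p ∈ t) (hx : ((u :: a :: t).map x).Nodup) :
    ((List.permutations'Aux u t).map fun l => wordTerm x r (a :: l)).sum =
      ((x a - x u)⁻¹ + (x u - x p)⁻¹) * wordTerm x r (a :: t) := by
  induction t generalizing a with
  | nil => simp at hp
  | cons b s ih =>
    have hap : a ≠ p := by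
      rintro rfl
      grind
    have hub : ∀ c ∈ u :: b :: s, ¬ r u c := fun c hc => hu c (by
      simp only [List.mem_cons] at hc ⊢
      tauto)
    have hau : ¬ r a u := by
      rw [hr a (by simp)]
      exact hap
    have hfirst : wordTerm x r (a :: u :: b :: s) =
        (if ∀ c ∈ a :: b :: s, ¬ r a c then (x a - x u)⁻¹ else 0) *
          ((x u - x b)⁻¹ * wordTerm x r (b :: s)) := by
      rw [wordTerm_cons_cons, wordTerm_cons_cons, if_pos hub]
      congr 1
      simp only [List.mem_cons]
      congr 1
      grind
    have hterm : ∀ l ∈ List.permutations'Aux u s, wordTerm x r (a :: b :: l) =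
        (if ∀ c ∈ a :: b :: s, ¬ r a c then (x a - x b)⁻¹ else 0) * wordTerm x r (b :: l) := by
      intro l hl
      rw [wordTerm_cons_cons]
      congr 1
      simp only [List.mem_cons, mem_of_mem_permutations'Aux hl]
      congr 1
      grind
    have hmap : (List.map ((fun l => wordTerm x r (a :: l)) ∘ List.cons b)
        (List.permutations'Aux u s)) = List.map (fun l =>
        (if ∀ c ∈ a :: b :: s, ¬ r a c then (x a - x b)⁻¹ else 0) * wordTerm x r (b :: l))
        (List.permutations'Aux u s) := List.map_congr_left hterm
    rw [List.permutations'Aux, List.map_cons, List.sum_cons, List.map_map, hfirst, hmap,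
      List.sum_map_mul_left, wordTerm_cons_cons (a := a)]
    have hxu : x u ≠ x a ∧ x u ≠ x b ∧ x a ≠ x b := by grind
    have e1' := sub_ne_zero.2 hxu.1.symm
    have e2 := sub_ne_zero.2 hxu.2.1
    have e2' := sub_ne_zero.2 hxu.2.1.symm
    have e3 := sub_ne_zero.2 hxu.2.2
    by_cases hbp : b = p
    · subst hbp
      have hz : List.map (fun l => wordTerm x r (b :: l)) (List.permutations'Aux u s) =
          List.map (fun _ => (0 : K)) (List.permutations'Aux u s) :=
        List.map_congr_left fun l hl => wordTerm_eq_zero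
          ((mem_of_mem_permutations'Aux hl).2 (Or.inl rfl)) ((hr b (by simp)).2 rfl)
      rw [hz]
      simp only [List.map_const', List.sum_replicate, smul_zero, mul_zero, add_zero]
      split_ifs
      · field_simp
        ring
      · ring
    · have hps : p ∈ s := by grind
      rw [ih (a := b) (by grind) (by grind) hps (by grind)]
      have e4 : x u - x p ≠ 0 := by
        refine sub_ne_zero.2 ?_
        have : x p ∈ s.map x := List.mem_map_of_mem hps
        grind
      split_ifs
      · field_simp
        ring
      · ring

theorem sum_insert_above {u p : ι} {l : List ι} (hu : ∀ c ∈ u :: l, ¬ r u c)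
    (hr : ∀ c ∈ l, r c u ↔ c = p) (hp : p ∈ l) (hx : ((u :: l).map x).Nodup) :
    ((List.permutations'Aux u l).map (wordTerm x r)).sum =
      (x u - x p)⁻¹ * wordTerm x r l := by
  obtain _ | ⟨a, t⟩ := l
  · simp at hp
  rw [List.permutations'Aux, List.map_cons, List.sum_cons, List.map_map, wordTerm_cons_cons,
    if_pos hu]
  by_cases hap : a = p
  · subst hap
    have hz : List.map (wordTerm x r ∘ List.cons a) (List.permutations'Aux u t) =
        List.map (fun _ => (0 : K)) (List.permutations'Aux u t) :=
      List.map_congr_left fun l hl => wordTerm_eq_zero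
        ((mem_of_mem_permutations'Aux hl).2 (Or.inl rfl)) ((hr a (by simp)).2 rfl)
    rw [hz]
    simp
  · have := sum_insert_between hu hr (by grind) hx
    rw [show wordTerm x r ∘ List.cons a = fun l => wordTerm x r (a :: l) from rfl, this,
      ← neg_sub (x a) (x u), inv_neg]
    ring

theorem sum_map_flatMap {α β M : Type*} [AddCommMonoid M] (l : List α) (f : α → List β)
    (g : β → M) : ((l.flatMap f).map g).sum = (l.map fun a => ((f a).map g).sum).sum := by
  induction l with
  | nil => simp
  | cons a l ih => simp [ih]

theorem wordSum_cons_of_forall {u : ι} {L : List ι} {c : K}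
    (h : ∀ l, l.Perm L →
      ((List.permutations'Aux u l).map (wordTerm x r)).sum = c * wordTerm x r l) :
    wordSum x r (u :: L) = c * wordSum x r L := by
  unfold wordSum
  rw [List.permutations', sum_map_flatMap, ← List.sum_map_mul_left]
  congr 1
  exact List.map_congr_left fun l hl => h l (List.mem_permutations'.1 hl)

/-- A letter whose only relation is to lie below `p` can be split off. -/
theorem wordSum_cons_below {u p : ι} {L : List ι} (hr : ∀ c ∈ u :: L, ¬ r c u)
    (hu : ∀ c ∈ L, r u c ↔ c = p) (hp : p ∈ L) (hx : ((u :: L).map x).Nodup) :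
    wordSum x r (u :: L) = (x p - x u)⁻¹ * wordSum x r L := by
  refine wordSum_cons_of_forall fun l hl => sum_insert_below (fun c hc => hr c ?_)
    (fun c hc => hu c (hl.mem_iff.1 hc)) (hl.mem_iff.2 hp) ?_
  · exact (hl.cons u).mem_iff.1 hc
  · exact ((hl.cons u).map x).nodup_iff.2 hx

/-- A letter whose only relation is to lie above `p` can be split off. -/
theorem wordSum_cons_above {u p : ι} {L : List ι} (hu : ∀ c ∈ u :: L, ¬ r u c)
    (hr : ∀ c ∈ L, r c u ↔ c = p) (hp : p ∈ L) (hx : ((u :: L).map x).Nodup) :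
    wordSum x r (u :: L) = (x u - x p)⁻¹ * wordSum x r L := by
  refine wordSum_cons_of_forall fun l hl => sum_insert_above (fun c hc => hu c ?_)
    (fun c hc => hr c (hl.mem_iff.1 hc)) (hl.mem_iff.2 hp) ?_
  · exact (hl.cons u).mem_iff.1 hc
  · exact ((hl.cons u).map x).nodup_iff.2 hx

end Words

/-- The nodes of the poset: `z i` on top, `x i` in the middle, `y i` below `x i` and `x (i + 1)`. -/
inductive FenceNode
  | z (i : ℕ)
  | x (i : ℕ)
  | y (i : ℕ)

namespace FenceNode

/-- The relation of the fence, with every `z i` on top of all the `x j` and `y j`. -/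
def Below : FenceNode → FenceNode → Prop
  | x _, z _ => True
  | y _, z _ => True
  | y i, x j => j = i ∨ j = i + 1
  | _, _ => False

/-- The fence on `x 0, …, x m` and `y 0, …, y (m - 1)`. -/
def fence : ℕ → List FenceNode
  | 0 => [x 0]
  | m + 1 => x (m + 1) :: y m :: fence m

/-- The relation in which `z j` is the least of the `z i`, keeping only the cover relations
among the nodes above `z j`. -/
def BelowVia (j : ℕ) (a b : FenceNode) : Prop :=
  (∃ i, a = z j ∧ b = z i ∧ i ≠ j) ∨ (Below a b ∧ ∀ i, b = z i → i = j)

theorem mem_fence {m : ℕ} {a : FenceNode} :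
    a ∈ fence m ↔ (∃ i, i ≤ m ∧ a = x i) ∨ ∃ i, i < m ∧ a = y i := by
  induction m with
  | zero => simp [fence]
  | succ m ih =>
    rw [fence, List.mem_cons, List.mem_cons, ih]
    rcases a with i | i | i
    · simp
    · simp only [x.injEq, reduceCtorEq, false_or, and_false, exists_false, or_false,
        exists_eq_right']
      omega
    · simp only [y.injEq, reduceCtorEq, false_or, and_false, exists_false, exists_eq_right']
      omega

theorem nodup_fence (m : ℕ) : (fence m).Nodup := by
  induction m with
  | zero => simp [fence]
  | succ m ih => simp [fence, ih, mem_fence]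

variable {K : Type*} [Field K] {val : FenceNode → K}

theorem wordSum_fence_succ {v m : ℕ} (h : ((fence (m + 1) ++ [z v]).map val).Nodup) :
    wordSum val Below (fence (m + 1) ++ [z v]) =
      (val (z v) - val (y m)) / ((val (z v) - val (x (m + 1))) *
        ((val (x m) - val (y m)) * (val (x (m + 1)) - val (y m)))) *
        wordSum val Below (fence m ++ [z v]) := by
  obtain ⟨D, hD⟩ : ∃ D, fence m ++ [z v] = D := ⟨_, rfl⟩
  have hmem : ∀ a, a ∈ D ↔ a = z v ∨ (∃ i, i ≤ m ∧ a = x i) ∨ ∃ i, i < m ∧ a = y i := by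
    intro a
    rw [← hD, List.mem_append, mem_fence, List.mem_singleton, or_comm]
  rw [fence, List.cons_append, List.cons_append, hD] at h ⊢
  have hV : z v ∈ D := by simp [hmem]
  have hP : x m ∈ D := by simp [hmem]
  have hX : x (m + 1) ∉ D := by simp [hmem]
  have hY : y m ∉ D := by simp [hmem]
  have nXYD := h.of_map
  have nXD : ((x (m + 1) :: D).map val).Nodup := by
    simp only [List.map_cons, List.nodup_cons, List.mem_cons] at h ⊢
    tauto
  have nYXD : ((y m :: x (m + 1) :: D).map val).Nodup :=
    (((List.Perm.swap (y m) (x (m + 1)) D).map val).nodup_iff.1 h :)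
  have nYXD' : (y m :: x (m + 1) :: D).Nodup := nYXD.of_map
  have nD : D.Nodup := nXD.of_map.of_cons
  let rX : FenceNode → FenceNode → Prop := fun a b => Below a b ∨ (a = x (m + 1) ∧ b = x m)
  let rP : FenceNode → FenceNode → Prop := fun a b => Below a b ∨ (a = x m ∧ b = x (m + 1))
  let rA : FenceNode → FenceNode → Prop := fun a b =>
    (a = y m ∧ b = x (m + 1)) ∨ (a = x (m + 1) ∧ b = x m) ∨
      (a ≠ y m ∧ a ≠ x (m + 1) ∧ Below a b)
  let rB : FenceNode → FenceNode → Prop := fun a b =>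
    (a = y m ∧ b = x m) ∨ (a ≠ y m ∧ rP a b)
  have hA₁ : wordSum val rX (x (m + 1) :: y m :: D) = wordSum val rA (y m :: x (m + 1) :: D) := by
    rw [wordSum_perm (List.Perm.swap (y m) (x (m + 1)) D)]
    refine wordSum_congr nYXD' fun pos => ⟨fun H a ha b hb hab => ?_, fun H a ha b hb hab => ?_⟩
    · refine H a ha b hb ?_
      rcases hab with ⟨rfl, rfl⟩ | h | h
      · exact Or.inl (Or.inr rfl)
      · exact Or.inr h
      · exact Or.inl h.2.2
    · have h1 := H (y m) (by simp) (x (m + 1)) (by simp) (Or.inl ⟨rfl, rfl⟩)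
      have h2 := H (x (m + 1)) (by simp) (x m) (by simp [hP]) (Or.inr (Or.inl ⟨rfl, rfl⟩))
      have h3 := H (x m) (by simp [hP]) (z v) (by simp [hV])
        (Or.inr (Or.inr ⟨by simp, by simp, trivial⟩))
      rcases hab with hab | ⟨rfl, rfl⟩
      · by_cases h4 : a = y m
        · subst h4
          rcases b with i | i | i
          · obtain rfl : i = v := by simpa [hmem] using hb
            omega
          · rcases hab with rfl | rfl <;> omega
          · exact hab.elim
        · by_cases h5 : a = x (m + 1)
          · subst h5
            rcases b with i | i | i
            · obtain rfl : i = v := by simpa [hmem] using hb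
              omega
            · exact hab.elim
            · exact hab.elim
          · exact H a ha b hb (Or.inr (Or.inr ⟨h4, h5, hab⟩))
      · exact h2
  have hA₂ : wordSum val rA (y m :: x (m + 1) :: D) =
      (val (x (m + 1)) - val (y m))⁻¹ * wordSum val rA (x (m + 1) :: D) := by
    refine wordSum_cons_below (fun c hc => ?_) (fun c hc => ?_) (by simp) nYXD
    · rcases c with i | i | i <;> simp [rA, Below]
    · simp [rA]
  have hA₃ : wordSum val rA (x (m + 1) :: D) =
      (val (x m) - val (x (m + 1)))⁻¹ * wordSum val rA D := by
    refine wordSum_cons_below (fun c hc => ?_) (fun c hc => ?_) hP nXD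
    · rcases c with i | i | i
      · simp [rA, Below]
      · simp [rA, Below]
      · have : i < m := by simpa [hmem] using hc
        simp [rA, Below]
        omega
    · simp [rA]
  have hA₄ : wordSum val rA D = wordSum val Below D := by
    refine wordSum_congr nD fun pos => forall₂_congr fun a ha => forall₂_congr fun b hb => ?_
    have h1 : a ≠ y m := fun h => hY (h ▸ ha)
    have h2 : a ≠ x (m + 1) := fun h => hX (h ▸ ha)
    simp [rA, h1, h2]
  have hB₁ : wordSum val rP (x (m + 1) :: y m :: D) = wordSum val rB (y m :: x (m + 1) :: D) := by
    rw [wordSum_perm (List.Perm.swap (y m) (x (m + 1)) D)]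
    refine wordSum_congr nYXD' fun pos => ⟨fun H a ha b hb hab => ?_, fun H a ha b hb hab => ?_⟩
    · refine H a ha b hb ?_
      rcases hab with ⟨rfl, rfl⟩ | h
      · exact Or.inl (Or.inl rfl)
      · exact h.2
    · have h1 := H (y m) (by simp) (x m) (by simp [hP]) (Or.inl ⟨rfl, rfl⟩)
      have h2 := H (x m) (by simp [hP]) (x (m + 1)) (by simp)
        (Or.inr ⟨by simp, Or.inr ⟨rfl, rfl⟩⟩)
      have h3 := H (x m) (by simp [hP]) (z v) (by simp [hV])
        (Or.inr ⟨by simp, Or.inl trivial⟩)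
      by_cases h4 : a = y m
      · subst h4
        rcases b with i | i | i
        · obtain rfl : i = v := by simpa [hmem] using hb
          omega
        · rcases hab with (rfl | rfl) | hab
          · omega
          · omega
          · simp at hab
        · rcases hab with hab | hab
          · exact hab.elim
          · simp at hab
      · exact H a ha b hb (Or.inr ⟨h4, hab⟩)
  have hB₂ : wordSum val rB (y m :: x (m + 1) :: D) =
      (val (x m) - val (y m))⁻¹ * wordSum val rB (x (m + 1) :: D) := by
    refine wordSum_cons_below (fun c hc => ?_) (fun c hc => ?_) (by simp [hP]) nYXD
    · rcases c with i | i | i <;> simp [rB, rP, Below]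
    · simp [rB]
  have hB₃ : wordSum val rB (x (m + 1) :: D) = wordSum val rP (x (m + 1) :: D) := by
    refine wordSum_congr nXD.of_map fun pos => forall₂_congr fun a ha =>
      forall₂_congr fun b hb => ?_
    have h1 : a ≠ y m := fun h => by
      subst h
      simp [hY] at ha
    simp [rB, h1]
  have hC₁ : wordSum val Below (x (m + 1) :: D) =
      wordSum val rX (x (m + 1) :: D) + wordSum val rP (x (m + 1) :: D) :=
    wordSum_split nXD.of_map (by simp) (by simp [hP]) (by simp)
  have hC₂ : wordSum val Below (x (m + 1) :: D) =
      (val (z v) - val (x (m + 1)))⁻¹ * wordSum val Below D := by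
    refine wordSum_cons_below (fun c hc => ?_) (fun c hc => ?_) hV nXD
    · rcases c with i | i | i
      · simp [Below]
      · simp [Below]
      · have : i < m := by simpa [hmem] using hc
        simp [Below]
        omega
    · rcases c with i | i | i
      · simpa [Below, hmem] using hc
      · simp [Below]
      · simp [Below]
  have hC₃ : wordSum val rX (x (m + 1) :: D) = wordSum val rA (x (m + 1) :: D) := by
    refine wordSum_congr nXD.of_map fun pos =>
      ⟨fun H a ha b hb hab => ?_, fun H a ha b hb hab => ?_⟩
    · refine H a ha b hb ?_
      rcases hab with ⟨rfl, rfl⟩ | h | h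
      · exact Or.inl (Or.inr rfl)
      · exact Or.inr h
      · exact Or.inl h.2.2
    · have h2 := H (x (m + 1)) (by simp) (x m) (by simp [hP]) (Or.inr (Or.inl ⟨rfl, rfl⟩))
      have h3 := H (x m) (by simp [hP]) (z v) (by simp [hV])
        (Or.inr (Or.inr ⟨by simp, by simp, trivial⟩))
      have h4 : a ≠ y m := fun h => by
        subst h
        simp [hY] at ha
      rcases hab with hab | ⟨rfl, rfl⟩
      · by_cases h5 : a = x (m + 1)
        · subst h5
          rcases b with i | i | i
          · obtain rfl : i = v := by simpa [hmem] using hb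
            omega
          · exact hab.elim
          · exact hab.elim
        · exact H a ha b hb (Or.inr (Or.inr ⟨h4, h5, hab⟩))
      · exact h2
  have hP' : wordSum val rP (x (m + 1) :: D) = wordSum val Below (x (m + 1) :: D) -
      wordSum val rX (x (m + 1) :: D) := by
    rw [hC₁]
    ring
  rw [wordSum_split (r := Below) nXYD (a := x (m + 1)) (b := x m) (by simp) (by simp [hP])
    (by simp)]
  change wordSum val rX (x (m + 1) :: y m :: D) + wordSum val rP (x (m + 1) :: y m :: D) = _
  rw [hA₁, hA₂, hB₁, hB₂, hB₃, hP', hC₂, hC₃, hA₃, hA₄]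
  have inj : ∀ a ∈ x (m + 1) :: y m :: D, ∀ b ∈ x (m + 1) :: y m :: D, a ≠ b →
      val a - val b ≠ 0 := fun a ha b hb hab h0 =>
    hab (List.inj_on_of_nodup_map h ha hb (sub_eq_zero.1 h0))
  have e1 := inj (z v) (by simp [hV]) (x (m + 1)) (by simp) (by simp)
  have e2 := inj (x m) (by simp [hP]) (y m) (by simp) (by simp)
  have e3 := inj (x (m + 1)) (by simp) (y m) (by simp) (by simp)
  have e4 := inj (x m) (by simp [hP]) (x (m + 1)) (by simp) (by simp)
  field_simp
  ring

theorem wordSum_fence {v m : ℕ} (h : ((fence m ++ [z v]).map val).Nodup) :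
    wordSum val Below (fence m ++ [z v]) =
      (∏ j ∈ Finset.range m, (val (z v) - val (y j))) /
        (∏ j ∈ Finset.range (m + 1), (val (z v) - val (x j))) /
        ∏ j ∈ Finset.range m, ((val (x j) - val (y j)) * (val (x (j + 1)) - val (y j))) := by
  induction m with
  | zero =>
    simp only [fence, List.singleton_append] at h ⊢
    rw [wordSum_cons_below (p := z v) (fun c hc => ?_) (fun c hc => ?_) (by simp) h]
    · simp [wordSum, wordTerm, ListsDown, wordWeight, Below]
    · rcases List.mem_cons.1 hc with rfl | hc
      · simp [Below]
      · simp_all [Below]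
    · simp_all [Below]
  | succ m ih =>
    have h' : ((fence m ++ [z v]).map val).Nodup := by
      rw [fence, List.cons_append, List.cons_append, List.map_cons, List.map_cons] at h
      exact h.of_cons.of_cons
    rw [wordSum_fence_succ h, ih h', Finset.prod_range_succ (fun j => val (z v) - val (y j)) m,
      Finset.prod_range_succ (fun j => val (z v) - val (x j)) (m + 1),
      Finset.prod_range_succ
        (fun j => (val (x j) - val (y j)) * (val (x (j + 1)) - val (y j))) m,
      div_div, div_div, div_mul_div_comm]
    congr 1 <;> ring

theorem wordSum_z_append {j m : ℕ} (s : List ℕ) (hj : j ∉ s)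
    (h : ((s.map z ++ (fence m ++ [z j])).map val).Nodup) :
    wordSum val (BelowVia j) (s.map z ++ (fence m ++ [z j])) =
      (s.map fun i => (val (z i) - val (z j))⁻¹).prod *
        wordSum val (BelowVia j) (fence m ++ [z j]) := by
  induction s with
  | nil => simp
  | cons i s ih =>
    have hij : i ≠ j := fun h => hj (by simp [h])
    have his : i ∉ s := fun h' => by
      have := h.of_map
      simp [h'] at this
    have hjs : j ∉ s := fun h => hj (by simp [h])
    rw [List.map_cons, List.cons_append] at h ⊢
    rw [wordSum_cons_above (p := z j) (fun c hc => ?_) (fun c hc => ?_) (by simp) h,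
      ih hjs (by
        rw [List.map_cons] at h
        exact h.of_cons), List.map_cons, List.prod_cons, mul_assoc]
    · rcases c with c | c | c <;> simp [BelowVia, Below, hij]
    · rcases c with c | c | c
      · simp [BelowVia, Below, hij]
      · simp [BelowVia, Below, hij]
      · simp [BelowVia, Below, hij]

theorem wordSum_eq_sum_belowVia {k m : ℕ} (hk : 0 < k) :
    wordSum val Below ((List.range k).map z ++ fence m) =
      ∑ j ∈ Finset.range k, wordSum val (BelowVia j) ((List.range k).map z ++ fence m) := by
  have hz : ∀ i, z i ∈ (List.range k).map z ++ fence m ↔ i < k := by simp [mem_fence]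
  refine wordSum_eq_sum ?_ _ _ fun pos hpos => ?_
  · refine List.Nodup.append ?_ (nodup_fence m) ?_
    · exact List.nodup_range.map fun a b h => by simpa using h
    · intro a ha hb
      simp only [List.mem_map] at ha
      obtain ⟨i, -, rfl⟩ := ha
      simp [mem_fence] at hb
  · obtain ⟨j₀, hj₀, hmax⟩ := Finset.exists_max_image (Finset.range k) (fun i => pos (z i))
      ⟨0, by simpa using hk⟩
    rw [Finset.mem_range] at hj₀
    by_cases hR : Reverses Below ((List.range k).map z ++ fence m) pos
    · have key : ∀ j ∈ Finset.range k,
          (Reverses (BelowVia j) ((List.range k).map z ++ fence m) pos ↔ j = j₀) := by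
        intro j hj
        rw [Finset.mem_range] at hj
        constructor
        · intro H
          by_contra hne
          have h1 := H (z j) ((hz _).2 hj) (z j₀) ((hz _).2 hj₀)
            (Or.inl ⟨j₀, rfl, rfl, fun h => hne h.symm⟩)
          have h2 : pos (z j) ≤ pos (z j₀) := hmax j (Finset.mem_range.2 hj)
          omega
        · rintro rfl a ha b hb (⟨i, rfl, rfl, hij⟩ | ⟨hab, -⟩)
          · have h2 := hmax i (Finset.mem_range.2 ((hz _).1 hb))
            refine lt_of_le_of_ne h2 fun h => hij ?_
            simpa using hpos _ hb _ ha h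
          · exact hR a ha b hb hab
      rw [if_pos hR, Finset.sum_congr rfl fun j hj => if_congr (key j hj) rfl rfl]
      simp [hj₀]
    · rw [if_neg hR, Finset.sum_eq_zero]
      intro j hj
      rw [Finset.mem_range] at hj
      refine if_neg fun H => hR fun a ha b hb hab => ?_
      by_cases hb' : ∀ i, b = z i → i = j
      · exact H a ha b hb (Or.inr ⟨hab, hb'⟩)
      · push Not at hb'
        obtain ⟨i, rfl, hij⟩ := hb'
        have h1 := H (z j) ((hz _).2 hj) (z i) hb (Or.inl ⟨i, rfl, rfl, hij⟩)
        have h2 := H a ha (z j) ((hz _).2 hj) (Or.inr ⟨?_, fun i h => ?_⟩)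
        · omega
        · rcases a with a | a | a
          · exact hab.elim
          · trivial
          · trivial
        · simpa using h.symm

theorem wordSum_z_fence {k m : ℕ} (hk : 0 < k)
    (h : (((List.range k).map z ++ fence m).map val).Nodup) :
    wordSum val Below ((List.range k).map z ++ fence m) =
      ∑ v ∈ Finset.range k, (∏ i ∈ (Finset.range k).erase v, (val (z i) - val (z v))⁻¹) *
      ((∏ j ∈ Finset.range m, (val (z v) - val (y j))) /
        (∏ j ∈ Finset.range (m + 1), (val (z v) - val (x j))) /
        ∏ j ∈ Finset.range m, ((val (x j) - val (y j)) * (val (x (j + 1)) - val (y j)))) := by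
  rw [wordSum_eq_sum_belowVia hk]
  refine Finset.sum_congr rfl fun v hv => ?_
  have hperm : ((List.range k).map z ++ fence m).Perm
      (((Finset.range k).erase v).toList.map z ++ (fence m ++ [z v])) := by
    refine (List.perm_ext_iff_of_nodup h.of_map ?_).2 fun a => ?_
    · refine List.Nodup.append ?_ (List.Nodup.append (nodup_fence m) (by simp) ?_) ?_
      · exact (Finset.nodup_toList _).map fun a b h => by simpa using h
      · simp [mem_fence]
      · intro a ha hb
        simp only [List.mem_map] at ha
        obtain ⟨i, hi, rfl⟩ := ha
        simp only [Finset.mem_toList, Finset.mem_erase] at hi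
        simp [mem_fence, hi.1] at hb
    · rw [Finset.mem_range] at hv
      rcases a with i | i | i
      · by_cases hiv : i = v
        · simp [hiv, hv]
        · simp [mem_fence, hiv]
      · simp [mem_fence]
      · simp [mem_fence]
  rw [(hperm.map val).nodup_iff] at h
  rw [wordSum_perm hperm, wordSum_z_append _ (by simp) h, Finset.prod_map_toList]
  rw [List.map_append] at h
  have h' := (List.nodup_append'.1 h).2.1
  rw [← wordSum_fence h']
  congr 1
  refine wordSum_congr h'.of_map fun pos => forall₂_congr fun a ha => forall₂_congr fun b hb => ?_
  rcases a with a | a | a <;> rcases b with b | b | b <;> simp_all [BelowVia, Below, mem_fence]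

end FenceNode

theorem permutations'_nodup {α : Type*} {L : List α} (hL : L.Nodup) : L.permutations'.Nodup :=
  (List.permutations_perm_permutations' L).nodup_iff.1 (List.nodup_permutations L hL)

theorem wordWeight_ofFn {ι K : Type*} [Field K] (x : ι → K) {N : ℕ} (f : Fin N → ι) :
    wordWeight x (List.ofFn f) = ∏ m : Fin (N - 1), (x (f (idxLo m)) - x (f (idxHi m)))⁻¹ := by
  obtain _ | N := N
  · simp [wordWeight]
  induction N with
  | zero => simp [wordWeight]
  | succ N ih =>
    have h := ih (fun i => f i.succ)
    rw [List.ofFn_succ, List.ofFn_succ, wordWeight, ← List.ofFn_succ (f := fun i => f i.succ), h]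
    exact (Fin.prod_univ_succ (fun m : Fin (N + 1) =>
      (x (f (idxLo (n := N + 2) m)) - x (f (idxHi (n := N + 2) m)))⁻¹)).symm

theorem listsDown_ofFn {ι : Type*} (r : ι → ι → Prop) {N : ℕ} (f : Fin N → ι) :
    ListsDown r (List.ofFn f) ↔ ∀ i j, r (f i) (f j) → j < i := by
  induction N with
  | zero => simp [ListsDown]
  | succ N ih =>
    rw [List.ofFn_succ, ListsDown, ih]
    simp only [List.mem_cons, List.mem_ofFn, forall_eq_or_imp, forall_exists_index,
      forall_apply_eq_imp_iff, Fin.forall_fin_succ, Fin.succ_lt_succ_iff, lt_self_iff_false,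
      Fin.succ_pos, Fin.not_lt_zero, imp_true_iff, imp_false, true_and]

theorem greeneSum_eq_wordSum {ι K : Type*} [Fintype ι] [Field K] (r : ι → ι → Prop) (x : ι → K) :
    greeneSum r x = wordSum x r (List.ofFn (Fintype.equivFin ι).symm) := by
  set e := (Fintype.equivFin ι).symm
  have hL : (List.ofFn e).Nodup := List.nodup_ofFn.2 e.injective
  rw [wordSum, ← List.sum_toFinset _ (permutations'_nodup hL), greeneSum]
  refine Finset.sum_bij (fun α _ => List.ofFn fun i => e (α i)) ?_ ?_ ?_ ?_
  · intro α _
    rw [List.mem_toFinset, List.mem_permutations']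
    refine (List.perm_ext_iff_of_nodup
      (List.nodup_ofFn.2 (e.injective.comp α.injective)) hL).2 fun a => ?_
    rw [List.mem_ofFn', List.mem_ofFn']
    exact iff_of_true ⟨α.symm (e.symm a), by simp⟩ (e.surjective a)
  · intro α _ β _ h
    ext i
    have := congrFun (List.ofFn_injective h) i
    rw [e.injective this]
  · intro l hl
    rw [List.mem_toFinset, List.mem_permutations'] at hl
    have hn : l.Nodup := hl.nodup_iff.2 hL
    have hlen : l.length = Fintype.card ι := by rw [hl.length_eq, List.length_ofFn]
    have hinj : Function.Injective fun i : Fin (Fintype.card ι) =>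
        e.symm (l.get (i.cast hlen.symm)) := fun i j h => by
      have := (List.nodup_iff_injective_get.1 hn) (e.symm.injective h)
      simpa using this
    refine ⟨Equiv.ofBijective _ (Finite.injective_iff_bijective.1 hinj), Finset.mem_univ _, ?_⟩
    refine List.ext_get (by simp [hlen]) fun i h1 h2 => ?_
    simp
  · intro α _
    rw [wordTerm]
    refine if_congr (listsDown_ofFn r _).symm ?_ rfl
    exact (wordWeight_ofFn x fun i => e (α i)).symm

theorem listsDown_map {ι κ : Type*} (r : κ → κ → Prop) (e : ι → κ) (l : List ι) :
    ListsDown r (l.map e) ↔ ListsDown (fun a b => r (e a) (e b)) l := by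
  induction l with
  | nil => simp [ListsDown]
  | cons a l ih => simp [ListsDown, ih]

theorem wordWeight_map {ι κ K : Type*} [Field K] (x : κ → K) (e : ι → κ) (l : List ι) :
    wordWeight x (l.map e) = wordWeight (x ∘ e) l := by
  induction l with
  | nil => simp [wordWeight]
  | cons a l ih =>
    cases l with
    | nil => simp [wordWeight]
    | cons b l => simpa [wordWeight] using Or.inl ih

theorem wordSum_map {ι κ K : Type*} [Field K] (x : κ → K) (r : κ → κ → Prop) (e : ι → κ)
    (L : List ι) :
    wordSum x r (L.map e) = wordSum (x ∘ e) (fun a b => r (e a) (e b)) L := by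
  rw [wordSum, ← List.map_permutations', List.map_map, wordSum]
  congr 1
  refine List.map_congr_left fun l _ => ?_
  simp [wordTerm, listsDown_map, wordWeight_map]

theorem prod_inv_sub_erase {K : Type*} [Field K] {k : ℕ} (w : Fin k → K) (v : Fin k) :
    ∏ i ∈ Finset.univ.erase v, (w i - w v)⁻¹ =
      (-1) ^ (k - 1) * (∏ i ∈ Finset.univ.erase v, (w v - w i))⁻¹ := by
  have h : ∀ i ∈ Finset.univ.erase v, (w i - w v)⁻¹ = -1 * (w v - w i)⁻¹ := fun i _ => by
    rw [← neg_sub, inv_neg, neg_one_mul]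
  rw [Finset.prod_congr rfl h, Finset.prod_mul_distrib, Finset.prod_inv_distrib]
  simp [Finset.card_erase_of_mem]

/-- For the poset `P(Z_k, X_n, Y_{n−1})` with `x_i ≺ z_j` for all
`i, j` and `y_i ≺ x_i`, `y_i ≺ x_{i+1}`, the Greene sum equals
`(−1)^{k−1} Δ_{Z_k}[g/f] / T(X_n, Y_{n−1})`. -/
theorem greeneSum_zigzag
    {K : Type*} [Field K] [CharZero K]
    {k n : ℕ} (hk : 0 < k) (hn : 0 < n)
    (zv : Fin k → K) (xv : Fin n → K) (yv : Fin (n - 1) → K)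
    (hinj : Function.Injective
      (Sum.elim zv (Sum.elim xv yv) : Fin k ⊕ (Fin n ⊕ Fin (n - 1)) → K)) :
    greeneSum
        (fun a b : Fin k ⊕ (Fin n ⊕ Fin (n - 1)) =>
          match a, b with
          | Sum.inr _, Sum.inl _ => True
          | Sum.inr (Sum.inr i), Sum.inr (Sum.inl j) => j.1 = i.1 ∨ j.1 = i.1 + 1
          | _, _ => False)
        (Sum.elim zv (Sum.elim xv yv)) =
      (-1 : K) ^ (k - 1) *
        dividedDiff zv
          (fun w => (∏ j : Fin (n - 1), (w - yv j)) / ∏ j : Fin n, (w - xv j)) /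
        ∏ j : Fin (n - 1), ((xv (idxLo j) - yv j) * (xv (idxHi j) - yv j)) := by
  obtain ⟨m, rfl⟩ : ∃ m, n = m + 1 := ⟨n - 1, by omega⟩
  let e : Fin k ⊕ (Fin (m + 1) ⊕ Fin (m + 1 - 1)) → FenceNode :=
    Sum.elim (fun i => .z i) (Sum.elim (fun i => .x i) fun i => .y i)
  have he : Function.Injective e := by
    rintro (i | i | i) (j | j | j) h <;> simp [e] at h <;> simp [Fin.ext_iff, h]
  let val : FenceNode → K := fun
    | .z i => if h : i < k then zv ⟨i, h⟩ else 0
    | .x i => if h : i < m + 1 then xv ⟨i, h⟩ else 0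
    | .y i => if h : i < m then yv ⟨i, h⟩ else 0
  have hz : ∀ i : Fin k, val (.z i) = zv i := fun i => by simp [val]
  have hx : ∀ i : Fin (m + 1), val (.x i) = xv i := fun i => dif_pos i.2
  have hy : ∀ i : Fin m, val (.y i) = yv i := fun i => by simp [val]
  have hval : val ∘ e = Sum.elim zv (Sum.elim xv yv) := by
    ext (i | i | i)
    · exact hz i
    · exact hx i
    · exact hy i
  set L := List.ofFn (Fintype.equivFin (Fin k ⊕ (Fin (m + 1) ⊕ Fin (m + 1 - 1)))).symm with hLdef
  have hL : L.Nodup := List.nodup_ofFn.2 (Equiv.injective _)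
  have hperm : (L.map e).Perm ((List.range k).map FenceNode.z ++ FenceNode.fence m) := by
    refine (List.perm_ext_iff_of_nodup (hL.map he) ?_).2 fun a => ?_
    · refine List.Nodup.append ?_ (FenceNode.nodup_fence m) ?_
      · exact List.nodup_range.map fun a b h => by simpa using h
      · intro a ha hb
        simp only [List.mem_map] at ha
        obtain ⟨i, -, rfl⟩ := ha
        simp [FenceNode.mem_fence] at hb
    · have hmem : ∀ a, a ∈ L := fun a => by
        rw [hLdef, List.mem_ofFn']
        exact Equiv.surjective _ a
      have : a ∈ L.map e ↔ ∃ b, e b = a := by simp [hmem]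
      rw [this, List.mem_append, FenceNode.mem_fence]
      rcases a with i | i | i
      · simp [e, Fin.exists_iff]
      · simp [e, Fin.exists_iff]
      · simp [e, Fin.exists_iff]
  have hnodup : (((List.range k).map FenceNode.z ++ FenceNode.fence m).map val).Nodup := by
    rw [← (hperm.map val).nodup_iff, List.map_map, hval]
    exact hL.map hinj
  rw [greeneSum_eq_wordSum, ← hval]
  refine (congrArg (fun r => wordSum (val ∘ e) r L)
    (a₂ := fun a b => FenceNode.Below (e a) (e b)) ?_).trans ?_
  · ext (i | i | i) (j | j | j) <;> rfl
  rw [← wordSum_map, wordSum_perm hperm, FenceNode.wordSum_z_fence hk hnodup, dividedDiff,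
    Finset.mul_sum, Finset.sum_div, Finset.sum_range]
  refine Finset.sum_congr rfl fun v _ => ?_
  have h1 : ∏ i ∈ (Finset.range k).erase v, (val (.z i) - val (.z v))⁻¹ =
      ∏ i ∈ Finset.univ.erase v, (zv i - zv v)⁻¹ := by
    have : (Finset.range k).erase v = (Finset.univ.erase v).map Fin.valEmbedding := by
      ext i
      simp
    rw [this, Finset.prod_map]
    exact Finset.prod_congr rfl fun i _ => by simp only [Fin.valEmbedding_apply, hz]
  have h2 : ∏ j ∈ Finset.range m, (val (.z v) - val (.y j)) =
      ∏ j : Fin (m + 1 - 1), (zv v - yv j) := by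
    rw [Finset.prod_range]
    exact Finset.prod_congr rfl fun j _ => by rw [hz, hy]
  have h3 : ∏ j ∈ Finset.range (m + 1), (val (.z v) - val (.x j)) =
      ∏ j : Fin (m + 1), (zv v - xv j) := by
    rw [Finset.prod_range]
    exact Finset.prod_congr rfl fun j _ => by rw [hz, hx]
  have h4 : ∏ j ∈ Finset.range m,
      ((val (.x j) - val (.y j)) * (val (.x (j + 1)) - val (.y j))) =
      ∏ j : Fin (m + 1 - 1), ((xv (idxLo j) - yv j) * (xv (idxHi j) - yv j)) := by
    rw [Finset.prod_range]
    refine Finset.prod_congr rfl fun j _ => ?_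
    have e1 : val (.x j) = xv (idxLo (n := m + 1) j) := hx (idxLo (n := m + 1) j)
    have e2 : val (.x (j + 1)) = xv (idxHi (n := m + 1) j) := hx (idxHi (n := m + 1) j)
    rw [e1, e2, hy]
  rw [h1, h2, h3, h4, prod_inv_sub_erase]
  ring

end
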